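/- arXiv:1307.6014 — 10 statements merged into one kernel-verified Lean document; each statement's English description precedes it below -/
import Mathlib

section
/- Let R be a commutative ring, A a multiplicative submonoid of R with 0 ∈ A whose subring closure is all of R, and let f : M →ₗ[R] N be a module homomorphism from an (A,R)-module (S,M) to an (A,R)-module (T,N). Then f is a categorical epimorphism — i.e. for every (A,R)-module (P,Q) and all module homomorphisms g, h : N →ₗ[R] Q from (T,N) to (P,Q), g ∘ f = h ∘ f implies g = h — if and only if the linear map f : M → N is surjective. -/
universe u

/-- A module homomorphism `f : (S,M) → (T,N)` of modules over a sesquiad `(A,R)` is a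
categorical epimorphism if and only if the underlying linear map `f : M → N` is
surjective. -/
theorem sesquiad_module_epi_iff_surjective
    {R M N : Type u} [CommRing R] [AddCommGroup M] [Module R M]
    [AddCommGroup N] [Module R N]
    (A : Submonoid R) (hA0 : (0 : R) ∈ A) (hAgen : Subring.closure (A : Set R) = ⊤)
    (S : Set M) (hS0 : (0 : M) ∈ S) (hSspan : Submodule.span R S = ⊤)
    (hSstab : ∀ a ∈ A, ∀ s ∈ S, a • s ∈ S)
    (T : Set N) (hT0 : (0 : N) ∈ T) (hTspan : Submodule.span R T = ⊤)
    (hTstab : ∀ a ∈ A, ∀ t ∈ T, a • t ∈ T)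
    (f : M →ₗ[R] N) (hf : f '' S ⊆ T) :
    (∀ (Q : Type u) [AddCommGroup Q] [Module R Q] (P : Set Q),
        (0 : Q) ∈ P → Submodule.span R P = ⊤ → (∀ a ∈ A, ∀ p ∈ P, a • p ∈ P) →
        ∀ g h : N →ₗ[R] Q, g '' T ⊆ P → h '' T ⊆ P →
          g ∘ₗ f = h ∘ₗ f → g = h) ↔
      Function.Surjective f := by
  constructor
  · intro H
    have h1 := H (N ⧸ LinearMap.range f) Set.univ (Set.mem_univ _) Submodule.span_univ
      (fun _ _ _ _ => Set.mem_univ _) (LinearMap.range f).mkQ 0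
      (Set.subset_univ _) (Set.subset_univ _) (by
        rw [LinearMap.range_mkQ_comp, LinearMap.zero_comp])
    have h2 := congrArg LinearMap.ker h1
    rw [Submodule.ker_mkQ, LinearMap.ker_zero] at h2
    exact LinearMap.range_eq_top.mp h2
  · intro hsurj Q _ _ P _ _ _ g h _ _ hgh
    ext n
    obtain ⟨m, rfl⟩ := hsurj n
    exact LinearMap.congr_fun hgh m
end

section
/- Let R be a commutative ring, A a multiplicative submonoid of R with 0 ∈ A whose subring closure is all of R, and let (S,M), (T,N), (U,P) be (A,R)-modules. Let b : S × T → U be a map such that: for every s ∈ S there exists an R-linear map βₛ : N →ₗ[R] P with βₛ t = b(s,t) for all t ∈ T, and for every t ∈ T there exists an R-linear map γₜ : M →ₗ[R] P with γₜ s = b(s,t) for all s ∈ S. Then there exists a unique R-linear map L : M ⊗[R] N →ₗ[R] P such that L(s ⊗ₜ t) = b(s,t) for all s ∈ S and t ∈ T; moreover L maps the set of pure tensors {s ⊗ₜ t : s ∈ S, t ∈ T} into U. -/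
open TensorProduct

/-- Every bilinear map `b : S × T → U` of sesquiad modules factors uniquely through
the pure-tensor map `S × T → S ⊙ T`: there is a unique linear map
`L : M ⊗[R] N → P` with `L (s ⊗ₜ t) = b (s, t)`, and `L` maps pure tensors of
elements of `S` and `T` into `U`. -/
theorem sesquiad_module_tensor_universal_property
    {R M N P : Type*} [CommRing R] [AddCommGroup M] [Module R M]
    [AddCommGroup N] [Module R N] [AddCommGroup P] [Module R P]
    (A : Submonoid R) (hA0 : (0 : R) ∈ A) (hAgen : Subring.closure (A : Set R) = ⊤)
    (S : Set M) (hS0 : (0 : M) ∈ S) (hSspan : Submodule.span R S = ⊤)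
    (hSstab : ∀ a ∈ A, ∀ s ∈ S, a • s ∈ S)
    (T : Set N) (hT0 : (0 : N) ∈ T) (hTspan : Submodule.span R T = ⊤)
    (hTstab : ∀ a ∈ A, ∀ t ∈ T, a • t ∈ T)
    (U : Set P) (hU0 : (0 : P) ∈ U) (hUspan : Submodule.span R U = ⊤)
    (hUstab : ∀ a ∈ A, ∀ u ∈ U, a • u ∈ U)
    (b : S × T → U)
    (hleft : ∀ s : S, ∃ β : N →ₗ[R] P, ∀ t : T, β t = b (s, t))
    (hright : ∀ t : T, ∃ γ : M →ₗ[R] P, ∀ s : S, γ s = b (s, t)) :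
    ∃ L : M ⊗[R] N →ₗ[R] P,
      (∀ (s : S) (t : T), L ((s : M) ⊗ₜ[R] (t : N)) = b (s, t)) ∧
      (∀ L' : M ⊗[R] N →ₗ[R] P,
        (∀ (s : S) (t : T), L' ((s : M) ⊗ₜ[R] (t : N)) = b (s, t)) → L' = L) ∧
      (∀ (s : S) (t : T), L ((s : M) ⊗ₜ[R] (t : N)) ∈ U) := by
  choose β hβ using hleft
  choose γ hγ using hright
  have key : ∀ m : M, ∃ f : N →ₗ[R] P, ∀ t : T, f t = γ t m := by
    intro m
    have hm : m ∈ Submodule.span R S := by rw [hSspan]; trivial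
    induction hm using Submodule.span_induction with
    | mem x hx => exact ⟨β ⟨x, hx⟩, fun t => by rw [hβ, ← hγ]⟩
    | zero => exact ⟨0, fun t => by simp⟩
    | add x y _ _ hx hy =>
      obtain ⟨f, hf⟩ := hx
      obtain ⟨g, hg⟩ := hy
      exact ⟨f + g, fun t => by simp [hf, hg]⟩
    | smul r x _ hx =>
      obtain ⟨f, hf⟩ := hx
      exact ⟨r • f, fun t => by simp [hf]⟩
  choose f hf using key
  let F : M →ₗ[R] N →ₗ[R] P :=
    { toFun := f
      map_add' := fun x y => LinearMap.ext_on hTspan fun t ht => by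
        have h := fun m => hf m ⟨t, ht⟩
        simp only at h
        simp [h]
      map_smul' := fun r x => LinearMap.ext_on hTspan fun t ht => by
        have h := fun m => hf m ⟨t, ht⟩
        simp only at h
        simp [h] }
  have hF : ∀ (s : S) (t : T),
      TensorProduct.lift F ((s : M) ⊗ₜ[R] (t : N)) = b (s, t) := by
    intro s t
    rw [TensorProduct.lift.tmul]
    exact (hf s t).trans (hγ t s)
  refine ⟨TensorProduct.lift F, hF, ?_, fun s t => by rw [hF]; exact (b (s, t)).2⟩
  intro L' hL'
  apply TensorProduct.ext
  refine LinearMap.ext_on hSspan fun s hs => LinearMap.ext_on hTspan fun t ht => ?_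
  exact (hL' ⟨s, hs⟩ ⟨t, ht⟩).trans (hF ⟨s, hs⟩ ⟨t, ht⟩).symm
end

section
/- Let R be a commutative ring, A a multiplicative submonoid of R with 0 ∈ A whose subring closure is all of R, let (S,M) be an (A,R)-module and let U ⊆ S be a subset with a • u ∈ U for all a ∈ A, u ∈ U and 0 ∈ U. Then U is full in (S,M), i.e. (Submodule.span R U : Set M) ∩ S = U, if and only if there exist an R-module N' and an R-linear map h : M →ₗ[R] N' such that U = {s ∈ S : h s = 0}. -/
universe u

/-- A submodule `U` of a sesquiad module `(S,M)` is full (equal to the intersection of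
its span with `S`) if and only if it is the kernel of some module homomorphism out of
`(S,M)`. -/
theorem sesquiad_submodule_full_iff_kernel
    {R M : Type u} [CommRing R] [AddCommGroup M] [Module R M]
    (A : Submonoid R) (hA0 : (0 : R) ∈ A) (hAgen : Subring.closure (A : Set R) = ⊤)
    (S : Set M) (hS0 : (0 : M) ∈ S) (hSspan : Submodule.span R S = ⊤)
    (hSstab : ∀ a ∈ A, ∀ s ∈ S, a • s ∈ S)
    (U : Set M) (hUS : U ⊆ S) (hU0 : (0 : M) ∈ U)
    (hUstab : ∀ a ∈ A, ∀ u ∈ U, a • u ∈ U) :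
    (Submodule.span R U : Set M) ∩ S = U ↔
      ∃ (N' : Type u) (_ : AddCommGroup N') (_ : Module R N') (h : M →ₗ[R] N'),
        U = {s ∈ S | h s = 0} := by
  constructor
  · intro hfull
    refine ⟨M ⧸ Submodule.span R U, inferInstance, inferInstance,
      (Submodule.span R U).mkQ, ?_⟩
    ext s
    rw [Set.mem_setOf_eq, Submodule.mkQ_apply, Submodule.Quotient.mk_eq_zero]
    constructor
    · intro hs
      exact ⟨hUS hs, Submodule.subset_span hs⟩
    · rintro ⟨hs, hsp⟩
      rw [← hfull]
      exact ⟨hsp, hs⟩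
  · rintro ⟨N', _, _, h, hU⟩
    have hle : Submodule.span R U ≤ LinearMap.ker h := by
      refine Submodule.span_le.mpr ?_
      intro u hu
      rw [hU] at hu
      exact LinearMap.mem_ker.mpr hu.2
    apply Set.Subset.antisymm
    · rintro s ⟨hsp, hs⟩
      have hz : h s = 0 := LinearMap.mem_ker.mp (hle hsp)
      rw [hU]
      exact ⟨hs, hz⟩
    · intro u hu
      exact ⟨Submodule.subset_span hu, hUS hu⟩
end

section
/- Let R be a commutative ring, A a multiplicative submonoid of R with 0 ∈ A whose subring closure is all of R, and let f : M →ₗ[R] N be a module homomorphism from an (A,R)-module (S,M) to an (A,R)-module (T,N). Let K = Submodule.span R {s ∈ S : f s = 0}; since K ≤ ker f, the map f induces an R-linear map g : M ⧸ K →ₗ[R] N with g ∘ (quotient map) = f. Then the following are equivalent: (1) g is injective and g '' ((quotient map) '' S) = Set.range f ∩ T; (2) f '' S = Set.range f ∩ T and ker f = K. (Condition (1) says the canonical map from the coimage of f to the image of f is an isomorphism, i.e. f is a strong morphism; condition (2) says f is full and the sequence M_{ker f} → M → N is exact.) -/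
/-- A module homomorphism `f : (S,M) → (T,N)` of sesquiad modules is strong (the
canonical map from the coimage to the image is an isomorphism) if and only if `f` is
full and the sequence `M_{ker f} → M → N` is exact, i.e. `ker f` is the span of the
kernel set `{s ∈ S | f s = 0}`. -/
theorem sesquiad_module_strong_iff_full_and_exact
    {R M N : Type*} [CommRing R] [AddCommGroup M] [Module R M]
    [AddCommGroup N] [Module R N]
    (A : Submonoid R) (hA0 : (0 : R) ∈ A) (hAgen : Subring.closure (A : Set R) = ⊤)
    (S : Set M) (hS0 : (0 : M) ∈ S) (hSspan : Submodule.span R S = ⊤)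
    (hSstab : ∀ a ∈ A, ∀ s ∈ S, a • s ∈ S)
    (T : Set N) (hT0 : (0 : N) ∈ T) (hTspan : Submodule.span R T = ⊤)
    (hTstab : ∀ a ∈ A, ∀ t ∈ T, a • t ∈ T)
    (f : M →ₗ[R] N) (hf : f '' S ⊆ T)
    (K : Submodule R M) (hK : K = Submodule.span R {s ∈ S | f s = 0})
    (hKker : K ≤ LinearMap.ker f)
    (g : M ⧸ K →ₗ[R] N) (hg : g ∘ₗ K.mkQ = f) :
    (Function.Injective g ∧ g '' (K.mkQ '' S) = Set.range f ∩ T) ↔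
      (f '' S = Set.range f ∩ T ∧ LinearMap.ker f = K) := by
  have hgx : ∀ x, g (K.mkQ x) = f x := fun x => by rw [← hg]; rfl
  have himg : g '' (K.mkQ '' S) = f '' S := by
    rw [Set.image_image]
    exact Set.image_congr fun x _ => hgx x
  have hinj : Function.Injective g ↔ LinearMap.ker f = K := by
    constructor
    · intro h
      refine le_antisymm (fun x hx => ?_) hKker
      have h0 : K.mkQ x = 0 := h (by rw [hgx, map_zero]; exact hx)
      exact (Submodule.Quotient.mk_eq_zero K).1 h0
    · intro h
      rw [injective_iff_map_eq_zero]
      intro y hy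
      obtain ⟨x, rfl⟩ := K.mkQ_surjective y
      rw [hgx] at hy
      have hx : x ∈ K := h ▸ LinearMap.mem_ker.2 hy
      exact (Submodule.Quotient.mk_eq_zero K).2 hx
  rw [himg, hinj, and_comm]
end

section
/- Let R be a commutative ring, A a multiplicative submonoid of R with 0 ∈ A whose subring closure is all of R, and let f : M →ₗ[R] N and g : N →ₗ[R] P be module homomorphisms of (A,R)-modules (S,M) → (T,N) → (U,P) (so f '' S ⊆ T, g '' T ⊆ U). Assume f and g are strong, i.e. f '' S = Set.range f ∩ T, ker f = Submodule.span R {s ∈ S : f s = 0}, g '' T = Set.range g ∩ U, and ker g = Submodule.span R {t ∈ T : g t = 0}. Assume moreover that the sequence is exact at T, i.e. g ∘ f = 0 and Set.range f ∩ T = (ker g : Set N) ∩ T. Then the sequence of R-modules M → N → P is exact, i.e. LinearMap.range f = LinearMap.ker g. -/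
/-- If `(S,M) → (T,N) → (U,P)` is a sequence of strong module homomorphisms of sesquiad
modules which is exact at `T`, then the ensuing sequence of `R`-modules `M → N → P` is
exact. -/
theorem sesquiad_module_strong_exact_implies_ring_exact
    {R M N P : Type*} [CommRing R] [AddCommGroup M] [Module R M]
    [AddCommGroup N] [Module R N] [AddCommGroup P] [Module R P]
    (A : Submonoid R) (hA0 : (0 : R) ∈ A) (hAgen : Subring.closure (A : Set R) = ⊤)
    (S : Set M) (hS0 : (0 : M) ∈ S) (hSspan : Submodule.span R S = ⊤)
    (hSstab : ∀ a ∈ A, ∀ s ∈ S, a • s ∈ S)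
    (T : Set N) (hT0 : (0 : N) ∈ T) (hTspan : Submodule.span R T = ⊤)
    (hTstab : ∀ a ∈ A, ∀ t ∈ T, a • t ∈ T)
    (U : Set P) (hU0 : (0 : P) ∈ U) (hUspan : Submodule.span R U = ⊤)
    (hUstab : ∀ a ∈ A, ∀ u ∈ U, a • u ∈ U)
    (f : M →ₗ[R] N) (hf : f '' S ⊆ T)
    (g : N →ₗ[R] P) (hg : g '' T ⊆ U)
    (hffull : f '' S = Set.range f ∩ T)
    (hfker : LinearMap.ker f = Submodule.span R {s ∈ S | f s = 0})
    (hgfull : g '' T = Set.range g ∩ U)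
    (hgker : LinearMap.ker g = Submodule.span R {t ∈ T | g t = 0})
    (hcomp : g ∘ₗ f = 0)
    (hexact : Set.range f ∩ T = (LinearMap.ker g : Set N) ∩ T) :
    LinearMap.range f = LinearMap.ker g := by
  apply le_antisymm
  · rintro _ ⟨m, rfl⟩
    exact LinearMap.congr_fun hcomp m
  · rw [hgker, Submodule.span_le]
    rintro t ⟨ht, hgt⟩
    have h : t ∈ Set.range f ∩ T := by
      rw [hexact]
      exact ⟨hgt, ht⟩
    exact h.1
end

section
/- Let R be a commutative ring, A a multiplicative submonoid of R with 0 ∈ A whose subring closure is all of R. Let 0 → (S,M) →α (T,N) →β (U,P) → 0 be a strong exact sequence of (A,R)-modules, i.e.: α : M →ₗ[R] N is injective with α '' S = Set.range α ∩ T, β : N →ₗ[R] P satisfies β '' T = U, and LinearMap.ker β = LinearMap.range α. Let (F, M_F) be any (A,R)-module. Then the tensored sequence F⊙S → F⊙T → F⊙U → 0 is exact; explicitly: (id_{M_F} ⊗ β) '' (F⊙T) = F⊙U, and Set.range (id_{M_F} ⊗ α) ∩ (F⊙T) = (ker (id_{M_F} ⊗ β) : Set (M_F ⊗[R] N)) ∩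 (F⊙T), where F⊙S = {x ⊗ₜ s : x ∈ F, s ∈ S} ⊆ M_F ⊗[R] M and similarly for F⊙T, F⊙U. -/
open TensorProduct

/-- Tensoring a strong exact sequence `0 → (S,M) → (T,N) → (U,P) → 0` of sesquiad
modules with an arbitrary sesquiad module `(F, M_F)` yields an exact sequence
`F⊙S → F⊙T → F⊙U → 0`. -/
theorem sesquiad_module_tensor_right_exact
    {R M N P MF : Type*} [CommRing R] [AddCommGroup M] [Module R M]
    [AddCommGroup N] [Module R N] [AddCommGroup P] [Module R P]
    [AddCommGroup MF] [Module R MF]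
    (A : Submonoid R) (hA0 : (0 : R) ∈ A) (hAgen : Subring.closure (A : Set R) = ⊤)
    (S : Set M) (hS0 : (0 : M) ∈ S) (hSspan : Submodule.span R S = ⊤)
    (hSstab : ∀ a ∈ A, ∀ s ∈ S, a • s ∈ S)
    (T : Set N) (hT0 : (0 : N) ∈ T) (hTspan : Submodule.span R T = ⊤)
    (hTstab : ∀ a ∈ A, ∀ t ∈ T, a • t ∈ T)
    (U : Set P) (hU0 : (0 : P) ∈ U) (hUspan : Submodule.span R U = ⊤)
    (hUstab : ∀ a ∈ A, ∀ u ∈ U, a • u ∈ U)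
    (F : Set MF) (hF0 : (0 : MF) ∈ F) (hFspan : Submodule.span R F = ⊤)
    (hFstab : ∀ a ∈ A, ∀ x ∈ F, a • x ∈ F)
    (α : M →ₗ[R] N) (hα : α '' S ⊆ T)
    (β : N →ₗ[R] P) (hβT : β '' T ⊆ U)
    (hαinj : Function.Injective α)
    (hαfull : α '' S = Set.range α ∩ T)
    (hβsurj : β '' T = U)
    (hker : LinearMap.ker β = LinearMap.range α) :
    (LinearMap.lTensor MF β '' {x : MF ⊗[R] N | ∃ y ∈ F, ∃ t ∈ T, y ⊗ₜ[R] t = x} =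
        {x : MF ⊗[R] P | ∃ y ∈ F, ∃ u ∈ U, y ⊗ₜ[R] u = x}) ∧
      (Set.range (LinearMap.lTensor MF α) ∩
          {x : MF ⊗[R] N | ∃ y ∈ F, ∃ t ∈ T, y ⊗ₜ[R] t = x} =
        (LinearMap.ker (LinearMap.lTensor MF β) : Set (MF ⊗[R] N)) ∩
          {x : MF ⊗[R] N | ∃ y ∈ F, ∃ t ∈ T, y ⊗ₜ[R] t = x}) := by
  have hsurj : Function.Surjective β := by
    rw [← LinearMap.range_eq_top, ← top_le_iff, ← hUspan, Submodule.span_le, ← hβsurj]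
    rintro _ ⟨t, _, rfl⟩
    exact ⟨t, rfl⟩
  have hex : Function.Exact α β := LinearMap.exact_iff.mpr hker
  have hT := lTensor_exact MF hex hsurj
  constructor
  · ext x
    constructor
    · rintro ⟨_, ⟨y, hy, t, ht, rfl⟩, rfl⟩
      exact ⟨y, hy, β t, hβT ⟨t, ht, rfl⟩, by simp⟩
    · rintro ⟨y, hy, u, hu, rfl⟩
      rw [← hβsurj] at hu
      obtain ⟨t, ht, rfl⟩ := hu
      exact ⟨y ⊗ₜ[R] t, ⟨y, hy, t, ht, rfl⟩, by simp⟩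
  · congr 1
    ext x
    exact (hT x).symm
end

section
/- Let R be a commutative ring, A a multiplicative submonoid of R with 0 ∈ A whose subring closure is all of R, and let (F, M_F) be an (A,R)-module such that M_F is a flat R-module. Then for every strong exact sequence 0 → (S,M) →α (T,N) →β (U,P) → 0 of (A,R)-modules (i.e. α : M →ₗ[R] N injective with α '' S = Set.range α ∩ T, β '' T = U, and ker β = range α), the tensored sequence 0 → F⊙S → F⊙T → F⊙U → 0 is exact; explicitly: {x ∈ F⊙S : (id_{M_F} ⊗ α) x = 0} = {0}, Set.range (id_{M_F} ⊗ α) ∩ (F⊙T) = (ker (id_{M_F} ⊗ β) : Set (M_F ⊗[R] N)) ∩ (F⊙T), and (id_{M_F} ⊗ β) '' (F⊙T) = F⊙U. -/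
open TensorProduct

/-- If `(F, M_F)` is a sesquiad module whose universal module `M_F` is flat over `R`,
then tensoring any strong exact sequence `0 → (S,M) → (T,N) → (U,P) → 0` with `F`
yields an exact sequence `0 → F⊙S → F⊙T → F⊙U → 0`. -/
theorem sesquiad_module_flat_tensor_exact
    {R M N P MF : Type*} [CommRing R] [AddCommGroup M] [Module R M]
    [AddCommGroup N] [Module R N] [AddCommGroup P] [Module R P]
    [AddCommGroup MF] [Module R MF] [Module.Flat R MF]
    (A : Submonoid R) (hA0 : (0 : R) ∈ A) (hAgen : Subring.closure (A : Set R) = ⊤)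
    (S : Set M) (hS0 : (0 : M) ∈ S) (hSspan : Submodule.span R S = ⊤)
    (hSstab : ∀ a ∈ A, ∀ s ∈ S, a • s ∈ S)
    (T : Set N) (hT0 : (0 : N) ∈ T) (hTspan : Submodule.span R T = ⊤)
    (hTstab : ∀ a ∈ A, ∀ t ∈ T, a • t ∈ T)
    (U : Set P) (hU0 : (0 : P) ∈ U) (hUspan : Submodule.span R U = ⊤)
    (hUstab : ∀ a ∈ A, ∀ u ∈ U, a • u ∈ U)
    (F : Set MF) (hF0 : (0 : MF) ∈ F) (hFspan : Submodule.span R F = ⊤)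
    (hFstab : ∀ a ∈ A, ∀ x ∈ F, a • x ∈ F)
    (α : M →ₗ[R] N) (hα : α '' S ⊆ T)
    (β : N →ₗ[R] P) (hβT : β '' T ⊆ U)
    (hαinj : Function.Injective α)
    (hαfull : α '' S = Set.range α ∩ T)
    (hβsurj : β '' T = U)
    (hker : LinearMap.ker β = LinearMap.range α) :
    ({x ∈ {x : MF ⊗[R] M | ∃ y ∈ F, ∃ s ∈ S, y ⊗ₜ[R] s = x} |
        LinearMap.lTensor MF α x = 0} = {0}) ∧
      (Set.range (LinearMap.lTensor MF α) ∩
          {x : MF ⊗[R] N | ∃ y ∈ F, ∃ t ∈ T, y ⊗ₜ[R] t = x} =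
        (LinearMap.ker (LinearMap.lTensor MF β) : Set (MF ⊗[R] N)) ∩
          {x : MF ⊗[R] N | ∃ y ∈ F, ∃ t ∈ T, y ⊗ₜ[R] t = x}) ∧
      (LinearMap.lTensor MF β '' {x : MF ⊗[R] N | ∃ y ∈ F, ∃ t ∈ T, y ⊗ₜ[R] t = x} =
        {x : MF ⊗[R] P | ∃ y ∈ F, ∃ u ∈ U, y ⊗ₜ[R] u = x}) := by
  have hex : Function.Exact α β := LinearMap.exact_iff.mpr hker
  have hsurj : Function.Surjective β := by
    rw [← LinearMap.range_eq_top, eq_top_iff, ← hUspan, Submodule.span_le, ← hβsurj]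
    rintro _ ⟨t, _, rfl⟩
    exact ⟨t, rfl⟩
  have hinj : Function.Injective (LinearMap.lTensor MF α) :=
    Module.Flat.lTensor_preserves_injective_linearMap α hαinj
  have hex2 : Function.Exact (LinearMap.lTensor MF α) (LinearMap.lTensor MF β) :=
    lTensor_exact MF hex hsurj
  refine ⟨?_, ?_, ?_⟩
  · ext x
    constructor
    · rintro ⟨_, hx⟩
      exact hinj (by rw [hx, map_zero])
    · rintro rfl
      exact ⟨⟨0, hF0, 0, hS0, by simp⟩, map_zero _⟩
  · congr 1
    ext x
    exact (hex2 x).symm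
  · ext x
    constructor
    · rintro ⟨_, ⟨y, hy, t, ht, rfl⟩, rfl⟩
      exact ⟨y, hy, β t, hβT ⟨t, ht, rfl⟩, by simp⟩
    · rintro ⟨y, hy, u, hu, rfl⟩
      rw [← hβsurj] at hu
      obtain ⟨t, ht, rfl⟩ := hu
      exact ⟨y ⊗ₜ[R] t, ⟨y, hy, t, ht, rfl⟩, by simp⟩
end

section
/- Let R be a commutative ring and A a multiplicative submonoid of R with 0 ∈ A whose subring closure is all of R. Suppose the sesquiad (A,R) is simple, i.e. for every commutative ring R', every multiplicative submonoid A' of R' with 0 ∈ A' whose subring closure is all of R', with R' nontrivial, and every ring homomorphism φ : R → R' with φ '' A ⊆ A', the restriction of φ to A is injective. Then every nonzero element of A is a unit of R: for all a ∈ A, a ≠ 0 → IsUnit a. -/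
universe u

/-- If a sesquiad `(A,R)` is simple (every sesquiad homomorphism to a nonzero sesquiad
is injective on `A`), then every nonzero element of `A` is a unit of `R`. -/
theorem sesquiad_simple_nonzero_elements_are_units
    {R : Type u} [CommRing R]
    (A : Submonoid R) (hA0 : (0 : R) ∈ A) (hAgen : Subring.closure (A : Set R) = ⊤)
    (hsimple : ∀ (R' : Type u) [CommRing R'] (A' : Submonoid R'),
      (0 : R') ∈ A' → Subring.closure (A' : Set R') = ⊤ → Nontrivial R' →
      ∀ φ : R →+* R', φ '' (A : Set R) ⊆ (A' : Set R') →
        Set.InjOn φ (A : Set R)) :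
    ∀ a ∈ A, a ≠ 0 → IsUnit a := by
  intro a ha hne
  by_contra hu
  have hnt : Nontrivial (R ⧸ Ideal.span {a}) :=
    Ideal.Quotient.nontrivial_iff.mpr fun h => hu (Ideal.span_singleton_eq_top.mp h)
  refine hne (hsimple (R ⧸ Ideal.span {a}) ⊤ trivial (by simp) hnt
    (Ideal.Quotient.mk _) (fun _ _ => trivial) ha hA0 ?_)
  rw [map_zero, Ideal.Quotient.eq_zero_iff_mem]
  exact Ideal.mem_span_singleton_self a
end

section
/- Let R be a commutative ring and A a multiplicative submonoid of R with 0 ∈ A whose subring closure is all of R. Then the sesquiad (A,R) is simple — i.e. for every commutative ring R', every multiplicative submonoid A' of R' with 0 ∈ A' whose subring closure is all of R', with R' nontrivial, and every ring homomorphism φ : R → R' with φ '' A ⊆ A', the map φ is injective on A — if and only if for all a, b ∈ A with a ≠ b, the element a − b is a unit of R. -/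
universe u

/-- A sesquiad `(A,R)` is simple if and only if the difference of any two distinct
elements of `A` is a unit of `R`. -/
theorem sesquiad_simple_iff_differences_are_units
    {R : Type u} [CommRing R]
    (A : Submonoid R) (hA0 : (0 : R) ∈ A) (hAgen : Subring.closure (A : Set R) = ⊤) :
    (∀ (R' : Type u) [CommRing R'] (A' : Submonoid R'),
      (0 : R') ∈ A' → Subring.closure (A' : Set R') = ⊤ → Nontrivial R' →
      ∀ φ : R →+* R', φ '' (A : Set R) ⊆ (A' : Set R') →
        Set.InjOn φ (A : Set R)) ↔
      (∀ a ∈ A, ∀ b ∈ A, a ≠ b → IsUnit (a - b)) := by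
  constructor
  · intro h a ha b hb hab
    by_contra hu
    have hne : Ideal.span {a - b} ≠ ⊤ := fun ht => hu (Ideal.span_singleton_eq_top.mp ht)
    have hnt : Nontrivial (R ⧸ Ideal.span {a - b}) := Ideal.Quotient.nontrivial_iff.mpr hne
    refine hab (h (R ⧸ Ideal.span {a - b}) ⊤ (Submonoid.mem_top _) ?_ hnt
      (Ideal.Quotient.mk _) (fun x _ => Submonoid.mem_top x) ha hb ?_)
    · rw [eq_top_iff]
      intro x _
      exact Subring.subset_closure (Submonoid.mem_top x)
    · exact Ideal.Quotient.eq.mpr (Ideal.mem_span_singleton_self _)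
  · intro h R' _ A' _ _ hnt φ _ a ha b hb hab
    by_contra hne
    have hu := (h a ha b hb hne).map φ
    rw [map_sub, hab, sub_self] at hu
    exact not_isUnit_zero hu
end

section
/- Let R be a commutative ring and A a multiplicative submonoid of R with 0 ∈ A whose subring closure is all of R, and suppose the sesquiad (A,R) is simple, i.e. for every commutative ring R', every multiplicative submonoid A' of R' with 0 ∈ A' whose subring closure is all of R', with R' nontrivial, and every ring homomorphism φ : R → R' with φ '' A ⊆ A', the map φ is injective on A. Let p ∈ Polynomial R be a polynomial all of whose coefficients lie in A and whose degree n = p.natDegree satisfies n ≥ 1. Then the set {a ∈ A : Polynomial.eval a p = 0} of roots of p in A is finite and has at most n elements. -/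
universe u

/-- Over a simple sesquiad `(A,R)`, a polynomial of degree `n ≥ 1` all of whose
coefficients lie in `A` has at most `n` roots in `A`. -/
theorem sesquiad_simple_polynomial_roots_le_degree
    {R : Type u} [CommRing R]
    (A : Submonoid R) (hA0 : (0 : R) ∈ A) (hAgen : Subring.closure (A : Set R) = ⊤)
    (hsimple : ∀ (R' : Type u) [CommRing R'] (A' : Submonoid R'),
      (0 : R') ∈ A' → Subring.closure (A' : Set R') = ⊤ → Nontrivial R' →
      ∀ φ : R →+* R', φ '' (A : Set R) ⊆ (A' : Set R') →
        Set.InjOn φ (A : Set R))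
    (p : Polynomial R) (hcoeff : ∀ i : ℕ, p.coeff i ∈ A)
    (hdeg : 1 ≤ p.natDegree) :
    {a : R | a ∈ A ∧ Polynomial.eval a p = 0}.Finite ∧
      {a : R | a ∈ A ∧ Polynomial.eval a p = 0}.ncard ≤ p.natDegree := by
  have hp0 : p ≠ 0 := by
    rintro rfl
    simp at hdeg
  have hnt : Nontrivial R := by
    by_contra h
    rw [not_nontrivial_iff_subsingleton] at h
    exact hp0 (Subsingleton.elim _ _)
  obtain ⟨M, hM⟩ := Ideal.exists_maximal R
  let φ : R →+* R ⧸ M := Ideal.Quotient.mk M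
  have hdom : IsDomain (R ⧸ M) := inferInstance
  have hinj : Set.InjOn φ (A : Set R) :=
    hsimple (R ⧸ M) ⊤ (Submonoid.mem_top _)
      (by simp) inferInstance φ
      (fun x _ => Submonoid.mem_top x)
  have hq0 : p.map φ ≠ 0 := by
    intro h
    apply hp0
    ext i
    have h1 : φ (p.coeff i) = φ 0 := by
      rw [← Polynomial.coeff_map, h]
      simp
    simpa using hinj (hcoeff i) hA0 h1
  set S : Set R := {a : R | a ∈ A ∧ Polynomial.eval a p = 0} with hS
  have hSinj : Set.InjOn φ S := hinj.mono (fun a ha => ha.1)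
  have hsub : φ '' S ⊆ (p.map φ).rootSet (R ⧸ M) := by
    rintro _ ⟨a, ha, rfl⟩
    rw [Polynomial.mem_rootSet]
    refine ⟨hq0, ?_⟩
    rw [Polynomial.coe_aeval_eq_eval, Polynomial.eval_map_apply, ha.2, map_zero]
  have hfin : ((p.map φ).rootSet (R ⧸ M)).Finite := Polynomial.rootSet_finite _ _
  refine ⟨Set.Finite.of_finite_image (hfin.subset hsub) hSinj, ?_⟩
  rw [← Set.ncard_image_of_injOn hSinj]
  exact (Set.ncard_le_ncard hsub hfin).trans
    ((Polynomial.ncard_rootSet_le _ _).trans Polynomial.natDegree_map_le)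
end
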